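/- arXiv:1903.08220 — 4 statements merged into one kernel-verified Lean document; each statement's English description precedes it below -/
import Mathlib

section
/- Let G be a finitely generated nilpotent group and let g, h ∈ G. Then g and h are conjugate in G if and only if for every normal subgroup N of G of finite index, the images of g and h in the quotient group G/N are conjugate. -/
open scoped commutatorElement IsMulCommutative

namespace Subgroup

variable {G G' : Type*} [Group G] [Group G']

theorem FG.exists_fg_le_map_eq {H : Subgroup G} {f : G →* G'} (h : (H.map f).FG) :
    ∃ P ≤ H, P.FG ∧ P.map f = H.map f := by
  classical
  obtain ⟨S, hS⟩ := h
  have hsub : (S : Set G') ⊆ f '' (H : Set G) := by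
    rw [← coe_map, ← hS]
    exact subset_closure
  obtain ⟨T, hT, rfl⟩ := Finset.subset_set_image_iff.mp hsub
  refine ⟨closure (T : Set G), (closure_le H).mpr hT, ⟨T, rfl⟩, ?_⟩
  rw [MonoidHom.map_closure, ← hS, Finset.coe_image]

theorem le_sup_ker_of_map_eq {H P : Subgroup G} {f : G →* G'} (hP : P ≤ H)
    (h : P.map f = H.map f) : H = P ⊔ H ⊓ f.ker := by
  refine le_antisymm (fun x hx => ?_) (sup_le hP inf_le_left)
  obtain ⟨p, hp, hpx⟩ : f x ∈ P.map f := h ▸ mem_map_of_mem f hx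
  rw [← mul_inv_cancel_left p x]
  refine mul_mem_sup hp ⟨H.mul_mem (H.inv_mem (hP hp)) hx, ?_⟩
  simp [hpx]

theorem FG.of_map_of_inf_ker {H : Subgroup G} {f : G →* G'} (h : (H.map f).FG)
    (hker : (H ⊓ f.ker).FG) : H.FG := by
  obtain ⟨P, hPH, hP, hmap⟩ := h.exists_fg_le_map_eq
  rw [le_sup_ker_of_map_eq hPH hmap]
  exact hP.sup hker

theorem fg_of_commGroup {A : Type*} [CommGroup A] [Group.FG A] (H : Subgroup A) : H.FG := by
  have : Module.Finite ℤ (Additive A) := Module.Finite.iff_addGroup_fg.mpr inferInstance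
  rw [fg_iff_add_fg, ← AddSubgroup.toIntSubmodule_toAddSubgroup H.toAddSubgroup,
    ← Submodule.fg_iff_addSubgroup_fg]
  exact IsNoetherian.noetherian _

theorem FG.of_le_of_le_center {H K : Subgroup G} (hK : K.FG) (hKc : K ≤ center G) (hHK : H ≤ K) :
    H.FG := by
  have : Group.FG K := (Group.fg_iff_subgroup_fg K).mpr hK
  have : IsMulCommutative K :=
    ⟨⟨fun a b => Subtype.ext (mem_center_iff.mp (hKc b.2) a)⟩⟩
  have h := fg_of_commGroup (H.subgroupOf K)
  rw [← map_subgroupOf_eq_of_le hHK]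
  exact ((fg_iff_submonoid_fg _).mp h |>.map K.subtype |> (fg_iff_submonoid_fg _).mpr)

theorem fg_commutator_top_of_fg_map [Group.FG G] (A : Subgroup G)
    (hc : ⁅A, (⊤ : Subgroup G)⁆ ≤ center G) [⁅A, (⊤ : Subgroup G)⁆.Normal]
    (hA : (A.map (QuotientGroup.mk' ⁅A, (⊤ : Subgroup G)⁆)).FG) :
    ⁅A, (⊤ : Subgroup G)⁆.FG := by
  obtain ⟨P, hPA, ⟨T, rfl⟩, hmap⟩ := hA.exists_fg_le_map_eq
  obtain ⟨S, hS⟩ := Group.fg_def.mp ‹Group.FG G›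
  set M : Subgroup G := closure (Set.image2 (fun t s => ⁅t, s⁆) (T : Set G) (S : Set G)) with hM
  have hTA : (T : Set G) ⊆ A := subset_closure.trans hPA
  have hMle : M ≤ ⁅A, (⊤ : Subgroup G)⁆ := by
    rw [hM, closure_le]
    rintro _ ⟨t, ht, s, -, rfl⟩
    exact commutator_mem_commutator (hTA ht) (mem_top s)
  have hMn : M.Normal := ⟨fun m hm g => by
    rwa [mem_center_iff.mp (hc (hMle hm)) g, mul_inv_cancel_right]⟩
  have hAM : A ≤ (center (G ⧸ M)).comap (QuotientGroup.mk' M) := by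
    rw [le_sup_ker_of_map_eq hPA hmap, QuotientGroup.ker_mk']
    refine sup_le ((closure_le _).mpr fun t ht => ?_) (inf_le_right.trans fun x hx => ?_)
    · have : (⊤ : Subgroup G) ≤
          (centralizer {QuotientGroup.mk' M t}).comap (QuotientGroup.mk' M) := by
        rw [← hS, closure_le]
        intro s hs
        have : ⁅t, s⁆ ∈ M := subset_closure ⟨t, ht, s, hs, rfl⟩
        rw [← QuotientGroup.eq_one_iff] at this
        simp only [SetLike.mem_coe, mem_comap, mem_centralizer_singleton_iff]
        exact (commutatorElement_eq_one_iff_mul_comm.mp this).symm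
      refine mem_center_iff.mpr fun q => ?_
      obtain ⟨g, rfl⟩ := QuotientGroup.mk'_surjective M q
      have h := this (mem_top g)
      rwa [mem_comap, mem_centralizer_singleton_iff] at h
    · refine mem_center_iff.mpr fun q => ?_
      obtain ⟨g, rfl⟩ := QuotientGroup.mk'_surjective M q
      rw [← map_mul, ← map_mul, mem_center_iff.mp (hc hx) g]
  have hle : ⁅A, (⊤ : Subgroup G)⁆ ≤ M := commutator_le.mpr fun a ha g _ => by
    rw [← QuotientGroup.eq_one_iff]
    exact commutatorElement_eq_one_iff_mul_comm.mpr (mem_center_iff.mp (hAM ha) g).symm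
  rw [le_antisymm hle hMle, fg_iff]
  exact ⟨_, rfl, T.finite_toSet.image2 _ S.finite_toSet⟩

theorem fg_of_lowerCentralSeries_eq_bot {G : Type*} [Group G] [Group.FG G] (n : ℕ)
    (hn : (⊤ : Subgroup G).lowerCentralSeries n = ⊥) (H : Subgroup G) : H.FG := by
  induction n generalizing G with
  | zero =>
    have : H = ⊥ := le_bot_iff.mp (hn ▸ le_top)
    exact this ▸ FG.bot
  | succ n ih =>
    set K : Subgroup G := (⊤ : Subgroup G).lowerCentralSeries n with hK
    have hKn : K.Normal := by rw [hK]; infer_instance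
    have hKc : K ≤ center G := fun x hx => mem_center_iff.mpr fun g => by
      have h : ⁅x, g⁆ ∈ (⊤ : Subgroup G).lowerCentralSeries (n + 1) :=
        commutator_mem_commutator hx (mem_top g)
      rw [hn, mem_bot] at h
      exact (commutatorElement_eq_one_iff_mul_comm.mp h).symm
    have hquot : ∀ H' : Subgroup (G ⧸ K), H'.FG := fun H' => ih (by
      rw [← map_top_of_surjective _ (QuotientGroup.mk'_surjective K), ← map_lowerCentralSeries,
        ← hK, map_eq_bot_iff, QuotientGroup.ker_mk']) H'
    have hKfg : K.FG := by
      cases n with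
      | zero => exact Group.fg_def.mp ‹_›
      | succ m => exact fg_commutator_top_of_fg_map _ hKc (hquot _)
    exact FG.of_map_of_inf_ker (hquot (H.map (QuotientGroup.mk' K)))
      (hKfg.of_le_of_le_center hKc (by rw [QuotientGroup.ker_mk']; exact inf_le_right))

end Subgroup

namespace Group.IsNilpotent

variable {G : Type*} [Group G] [Group.FG G] [Group.IsNilpotent G]

theorem subgroup_fg (H : Subgroup G) : H.FG := by
  obtain ⟨n, hn⟩ := Subgroup.nilpotent_iff_lowerCentralSeries.mp ‹Group.IsNilpotent G›
  exact Subgroup.fg_of_lowerCentralSeries_eq_bot n hn H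

theorem wellFoundedGT_subgroup : WellFoundedGT (Subgroup G) := by
  rw [wellFoundedGT_iff_monotone_chain_condition]
  intro a
  obtain ⟨S, hS⟩ := subgroup_fg (⨆ i, a i)
  have hSa : ∀ s ∈ S, ∃ i, s ∈ a i := fun s hs =>
    (Subgroup.mem_iSup_of_directed a.monotone.directed_le).mp (hS ▸ Subgroup.subset_closure hs)
  choose! i hi using hSa
  refine ⟨S.sup i, fun m hm => le_antisymm (a.monotone hm) ?_⟩
  calc a m ≤ ⨆ i, a i := le_iSup a m
    _ = Subgroup.closure S := hS.symm
    _ ≤ a (S.sup i) :=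
      (Subgroup.closure_le _).mpr fun s hs => a.monotone (Finset.le_sup hs) (hi s hs)

theorem finite_of_finite_center [Finite (Subgroup.center G)] : Finite G := by
  obtain ⟨S, hS⟩ := Group.fg_def.mp ‹Group.FG G›
  have hfin : ∀ n, (Subgroup.upperCentralSeries G n : Set G).Finite := by
    intro n
    induction n with
    | zero => simp
    | succ n ih =>
      refine Set.Finite.of_finite_fibers (fun (x : G) (s : S) => ⁅x, (s : G)⁆)
        ((Set.Finite.pi' fun _ => ih).subset ?_) ?_
      · rintro _ ⟨x, hx, rfl⟩ s
        exact Subgroup.mem_upperCentralSeries_succ_iff.mp hx s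
      · rintro _ ⟨x, -, rfl⟩
        refine ((Set.toFinite (Subgroup.center G : Set G)).image (x * ·)).subset ?_
        rintro y ⟨-, hy⟩
        refine ⟨x⁻¹ * y, ?_, mul_inv_cancel_left x y⟩
        have hle : (⊤ : Subgroup G) ≤ Subgroup.centralizer {x⁻¹ * y} := by
          rw [← hS, Subgroup.closure_le]
          intro s hs
          have h : y * s * y⁻¹ = x * s * x⁻¹ := by
            simpa [commutatorElement_def] using congrFun hy ⟨s, hs⟩
          rw [SetLike.mem_coe, Subgroup.mem_centralizer_singleton_iff]
          calc s * (x⁻¹ * y) = x⁻¹ * (x * s * x⁻¹) * y := by group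
            _ = x⁻¹ * y * s := by rw [← h]; group
        exact Subgroup.mem_center_iff.mpr fun g =>
          Subgroup.mem_centralizer_singleton_iff.mp (hle (Subgroup.mem_top g))
  obtain ⟨n, hn⟩ := IsNilpotent.nilpotent G
  have h := hfin n
  rw [hn, Subgroup.coe_top] at h
  exact Set.finite_univ_iff.mp h

theorem exists_mem_center_not_isOfFinOrder [Infinite G] :
    ∃ w ∈ Subgroup.center G, ¬ IsOfFinOrder w := by
  by_contra! hw
  have : Group.FG (Subgroup.center G) := (Group.fg_iff_subgroup_fg _).mpr (subgroup_fg _)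
  have : Finite (Subgroup.center G) := CommGroup.finite_of_fg_isMulTorsion _ fun x =>
    Submonoid.isOfFinOrder_coe.mp (hw x x.2)
  exact not_finite_iff_infinite.mpr ‹Infinite G› finite_of_finite_center

end Group.IsNilpotent

theorem IsConj.mul_left_of_mem_center {G : Type*} [Group G] {z a b : G}
    (hz : z ∈ Subgroup.center G) (h : IsConj a b) : IsConj (z * a) (z * b) := by
  obtain ⟨c, rfl⟩ := isConj_iff.mp h
  refine isConj_iff.mpr ⟨c, ?_⟩
  rw [← mul_assoc c, Subgroup.mem_center_iff.mp hz c]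
  simp only [mul_assoc]

theorem QuotientGroup.isConj_mk_iff {G : Type*} [Group G] {K : Subgroup G} [K.Normal] {g h : G} :
    IsConj (g : G ⧸ K) (h : G ⧸ K) ↔ ∃ k ∈ K, IsConj g (k * h) := by
  constructor
  · intro hc
    obtain ⟨q, hq⟩ := isConj_iff.mp hc
    obtain ⟨c, rfl⟩ := QuotientGroup.mk_surjective q
    refine ⟨c * g * c⁻¹ * h⁻¹, ?_, isConj_iff.mpr ⟨c, by simp⟩⟩
    rw [← QuotientGroup.eq_one_iff]
    simp only [QuotientGroup.mk_mul, QuotientGroup.mk_inv, hq, mul_inv_cancel]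
  · rintro ⟨k, hk, hc⟩
    have := (QuotientGroup.mk' K).map_isConj hc
    rwa [map_mul, QuotientGroup.mk'_apply, QuotientGroup.mk'_apply, QuotientGroup.mk'_apply,
      (QuotientGroup.eq_one_iff k).mpr hk, one_mul] at this

/-- If a group has a central element of infinite order, then conjugacy can be tested in its proper
quotients. -/
theorem isConj_of_forall_isConj_mk {G : Type*} [Group G] {w : G} (hw : w ∈ Subgroup.center G)
    (hinf : ¬ IsOfFinOrder w) {g h : G}
    (H : ∀ K : Subgroup G, ∀ _ : K.Normal, K ≠ ⊥ → IsConj (g : G ⧸ K) (h : G ⧸ K)) :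
    IsConj g h := by
  have hinj := injective_zpow_iff_not_isOfFinOrder.mpr hinf
  have hc : ∀ n : ℤ, w ^ n ∈ Subgroup.center G := fun n => Subgroup.zpow_mem _ hw n
  have key : ∀ n : ℤ, n ≠ 0 → ∃ k : ℤ, IsConj g (w ^ (n * k) * h) := by
    intro n hn
    have hnormal : (Subgroup.zpowers (w ^ n)).Normal := ⟨fun m hm x => by
      have hmc := Subgroup.zpowers_le.mpr (hc n) hm
      rwa [Subgroup.mem_center_iff.mp hmc x, mul_inv_cancel_right]⟩
    have hne : Subgroup.zpowers (w ^ n) ≠ ⊥ := by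
      rw [Ne, Subgroup.zpowers_eq_bot]
      exact fun h1 => hn (hinj (by simpa using h1))
    obtain ⟨_, ⟨k, rfl⟩, hk⟩ := QuotientGroup.isConj_mk_iff.mp (H _ hnormal hne)
    exact ⟨k, by simpa [zpow_mul] using hk⟩
  by_cases hb : ∃ b : ℤ, b ≠ 0 ∧ IsConj (w ^ b * h) h
  · obtain ⟨b, hb0, hb⟩ := hb
    obtain ⟨k, hk⟩ := key b hb0
    have hpow : ∀ k : ℕ, IsConj (w ^ (b * k) * h) h := by
      intro k
      induction k with
      | zero => simpa using IsConj.refl h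
      | succ k ih =>
        have := (hb.mul_left_of_mem_center (hc (b * k))).trans ih
        rwa [← mul_assoc, ← zpow_add, ← mul_add_one, ← Nat.cast_succ] at this
    obtain ⟨m, rfl | rfl⟩ := k.eq_nat_or_neg
    · exact hk.trans (hpow m)
    · have := (hpow m).mul_left_of_mem_center (hc (b * -m))
      rw [← mul_assoc, ← zpow_add, mul_neg, neg_add_cancel, zpow_zero, one_mul, ← mul_neg] at this
      exact hk.trans this.symm
  · push Not at hb
    obtain ⟨a, ha⟩ := key 1 one_ne_zero
    rw [one_mul] at ha
    rcases eq_or_ne a 0 with rfl | ha0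
    · simpa using ha
    obtain ⟨k, hk⟩ := key (2 * a) (by simpa)
    have := (hk.symm.trans ha).mul_left_of_mem_center (hc (-a))
    rw [← mul_assoc, ← zpow_add, ← mul_assoc, ← zpow_add, neg_add_cancel, zpow_zero,
      one_mul] at this
    refine absurd this (hb _ fun h0 => ?_)
    have : a * (2 * k - 1) = 0 := by linarith
    rcases mul_eq_zero.mp this with h | h
    · exact ha0 h
    · omega

/-- Blackburn's theorem: in a finitely generated nilpotent group, two elements
are conjugate iff their images are conjugate in every finite quotient. -/
theorem conj_iff_conj_in_finite_quotients
    {G : Type*} [Group G] [Group.FG G] [Group.IsNilpotent G] (g h : G) :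
    IsConj g h ↔
      ∀ (N : Subgroup G) (hN : N.Normal), N.FiniteIndex →
        haveI := hN
        IsConj ((QuotientGroup.mk g : G ⧸ N)) (QuotientGroup.mk h) := by
  refine ⟨fun hc N hN _ => (QuotientGroup.mk' N).map_isConj hc, fun H => ?_⟩
  have hwf : WellFoundedGT (Subgroup G) := Group.IsNilpotent.wellFoundedGT_subgroup
  have main : ∀ N : Subgroup G, ∀ _ : N.Normal, IsConj (g : G ⧸ N) (h : G ⧸ N) := by
    intro N
    induction N using hwf.induction with
    | _ N ih =>
      intro hN
      by_cases hfin : N.FiniteIndex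
      · exact H N hN hfin
      have : Infinite (G ⧸ N) := by
        rw [← not_finite_iff_infinite]
        exact fun _ => hfin Subgroup.finiteIndex_of_finite_quotient
      obtain ⟨w, hw, hinf⟩ :=
        Group.IsNilpotent.exists_mem_center_not_isOfFinOrder (G := G ⧸ N)
      refine isConj_of_forall_isConj_mk hw hinf fun K hK hKne => ?_
      have hlt : N < K.comap (QuotientGroup.mk' N) := by
        refine lt_of_le_of_ne (QuotientGroup.le_comap_mk' N K) fun heq => hKne ?_
        rw [← Subgroup.map_comap_eq_self_of_surjective (QuotientGroup.mk'_surjective N) K, ← heq,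
          QuotientGroup.map_mk'_self]
      obtain ⟨k, hk, hc⟩ := QuotientGroup.isConj_mk_iff.mp (ih _ hlt inferInstance)
      exact QuotientGroup.isConj_mk_iff.mpr ⟨k, hk, (QuotientGroup.mk' N).map_isConj hc⟩
  obtain ⟨k, hk, hc⟩ := QuotientGroup.isConj_mk_iff.mp (main ⊥ inferInstance)
  rwa [Subgroup.mem_bot.mp hk, one_mul] at hc
end

section
/- Let G be a finitely generated nilpotent group, let H be a subgroup of G, and suppose g ∈ G \ H is an element such that g^n ∉ H for every integer n ≥ 1. Then for any prime p there exist a finite p-group K and a surjective group homomorphism φ : G → K such that φ(g) ∉ φ(H). -/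
open Subgroup in
/-- A finitely generated solvable group all of whose elements have finite order is finite. -/
theorem finite_of_fg_of_isSolvable_of_torsion {G : Type*} [Group G] [Group.FG G]
    [Group.IsSolvable G] (h : ∀ x : G, IsOfFinOrder x) : Finite G := by
  have key : ∀ n, (derivedSeries G n).FiniteIndex := by
    intro n
    induction n with
    | zero => rw [derivedSeries_zero]; infer_instance
    | succ n ih =>
      set D := derivedSeries G n
      have : Group.FG (Abelianization D) := QuotientGroup.fg (commutator D)
      have hfin : Finite (Abelianization D) := by
        apply CommGroup.finite_of_fg_isMulTorsion
        intro x
        induction x using QuotientGroup.induction_on with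
        | H x =>
          have hx : IsOfFinOrder x := Submonoid.isOfFinOrder_coe.mp (h x)
          exact (QuotientGroup.mk' (commutator D)).isOfFinOrder hx
      have hc : (commutator D).FiniteIndex :=
        @Subgroup.finiteIndex_of_finite_quotient _ _ _ hfin
      rw [derivedSeries_succ, ← map_subtype_commutator]
      refine ⟨?_⟩
      rw [Subgroup.index_map_subtype]
      exact mul_ne_zero hc.index_ne_zero ih.index_ne_zero
  obtain ⟨n, hn⟩ := Group.IsSolvable.solvable (G := G)
  have := key n
  rw [hn] at this
  exact Subgroup.finite_iff_finite_and_finiteIndex (⊥ : Subgroup G) |>.mpr ⟨inferInstance, this⟩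

open Subgroup in
/-- In a finitely generated group whose center is a `p`-group, the center of the central quotient
is a `p`-group. -/
theorem IsPGroup.center_quotient_center {G : Type*} [Group G] [Group.FG G] {p : ℕ}
    (h : IsPGroup p (center G)) : IsPGroup p (center (G ⧸ center G)) := by
  rintro ⟨x, hx⟩
  induction x using QuotientGroup.induction_on with
  | H x =>
  have hcomm : ∀ s : G, ∃ c ∈ center G, s⁻¹ * x * s = x * c := by
    intro s
    refine ⟨x⁻¹ * (s⁻¹ * x * s), ?_, by group⟩
    rw [← QuotientGroup.eq_one_iff]
    have := mem_center_iff.mp hx (s : G ⧸ center G)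
    simp only [QuotientGroup.mk_mul, QuotientGroup.mk_inv]
    rw [mul_assoc _ (x : G ⧸ center G), ← this]
    group
  choose c hc hxc using hcomm
  obtain ⟨S, hS, hfin⟩ := Group.fg_iff.mp ‹Group.FG G›
  choose e he using fun s => h ⟨c s, hc s⟩
  obtain ⟨E, hE⟩ := (hfin.image e).bddAbove
  refine ⟨E, Subtype.ext ?_⟩
  rw [Subgroup.coe_pow, Subgroup.coe_one, ← QuotientGroup.mk_pow, QuotientGroup.eq_one_iff]
  have hle : closure S ≤ centralizer {x ^ p ^ E} := by
    rw [closure_le]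
    intro s hs
    rw [SetLike.mem_coe, mem_centralizer_singleton_iff]
    have hcE : c s ^ p ^ E = 1 := by
      have hes : c s ^ p ^ e s = 1 := congrArg Subtype.val (he s)
      rw [← Nat.sub_add_cancel (hE (Set.mem_image_of_mem e hs)), add_comm, pow_add, pow_mul, hes,
        one_pow]
    have hconj : s⁻¹ * x ^ p ^ E * s = x ^ p ^ E := by
      have := conj_pow (i := p ^ E) (a := s⁻¹) (b := x)
      rw [inv_inv, hxc, (show Commute x (c s) from mem_center_iff.mp (hc s) x).mul_pow, hcE,
        mul_one] at this
      exact this.symm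
    rw [mul_assoc, inv_mul_eq_iff_eq_mul] at hconj
    exact hconj.symm
  refine mem_center_iff.mpr fun y => mem_centralizer_singleton_iff.mp (hle ?_)
  rw [hS]
  exact mem_top y

/-- A finitely generated nilpotent group whose center is a `p`-group is a `p`-group. -/
theorem IsPGroup.of_center {G : Type*} [Group G] [Group.FG G] [Group.IsNilpotent G] {p : ℕ}
    (h : IsPGroup p (Subgroup.center G)) : IsPGroup p G := by
  revert h
  have hfg := ‹Group.FG G›
  revert hfg
  refine Group.nilpotent_center_quotient_ind
    (P := fun G _ _ => Group.FG G → IsPGroup p (Subgroup.center G) → IsPGroup p G) G ?_ ?_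
  · exact fun G _ _ _ _ x => ⟨0, Subsingleton.elim _ _⟩
  · intro G _ _ ih _ h x
    obtain ⟨a, ha⟩ := ih inferInstance h.center_quotient_center x
    rw [← QuotientGroup.mk_pow, QuotientGroup.eq_one_iff] at ha
    obtain ⟨b, hb⟩ := h ⟨_, ha⟩
    exact ⟨a + b, by simpa [pow_add, pow_mul] using congrArg Subtype.val hb⟩

/-- No power of `g` with exponent prime to `p` lies in `H`. -/
def AvoidsCoprimePowers {G : Type*} [Group G] (p : ℕ) (g : G) (H : Subgroup G) : Prop :=
  ∀ m : ℕ, m.Coprime p → g ^ m ∉ H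

theorem AvoidsCoprimePowers.exists_le_maximal {G : Type*} [Group G] {p : ℕ} {g : G}
    {H : Subgroup G} (h : AvoidsCoprimePowers p g H) :
    ∃ M, H ≤ M ∧ Maximal (AvoidsCoprimePowers p g) M := by
  refine zorn_le_nonempty₀ {K | AvoidsCoprimePowers p g K} (fun c hc hchain y hy => ?_) H h
  refine ⟨sSup c, fun m hm hmem => ?_, fun z hz => le_sSup hz⟩
  obtain ⟨K, hK, hgK⟩ := (Subgroup.mem_sSup_of_directedOn ⟨y, hy⟩ hchain.directedOn).mp hmem
  exact hc hK m hm hgK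

theorem AvoidsCoprimePowers.maximal_map {G Q : Type*} [Group G] [Group Q] {p : ℕ} {g : G}
    {H : Subgroup G} (h : Maximal (AvoidsCoprimePowers p g) H) {f : G →* Q}
    (hf : Function.Surjective f) (hker : f.ker ≤ H) :
    Maximal (AvoidsCoprimePowers p (f g)) (H.map f) := by
  have hcomap : ∀ K : Subgroup Q,
      AvoidsCoprimePowers p (f g) K ↔ AvoidsCoprimePowers p g (K.comap f) := by
    simp [AvoidsCoprimePowers]
  refine ⟨?_, fun K hK hle => ?_⟩
  · rw [hcomap, Subgroup.comap_map_eq_self hker]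
    exact h.prop
  · have := h.le_of_ge ((hcomap K).mp hK) (Subgroup.map_le_iff_le_comap.mp hle)
    rw [← Subgroup.map_comap_eq_self_of_surjective hf K]
    exact Subgroup.map_mono this

open Subgroup in
/-- If `H` is maximal among the subgroups containing no power of `g` with exponent prime to `p`
and `H` meets the center trivially, then the center is a `p`-group. -/
theorem AvoidsCoprimePowers.isPGroup_center {G : Type*} [Group G] {p : ℕ} (hp : p.Prime) {g : G}
    {H : Subgroup G} (h : Maximal (AvoidsCoprimePowers p g) H) (hdisj : Disjoint H (center G)) :
    IsPGroup p (center G) := by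
  rintro ⟨z, hz⟩
  by_contra! hne
  have hone : ∀ w ∈ center G, w ∈ H → w = 1 := fun w hw hwH => disjoint_def.mp hdisj hwH hw
  have hpow : ∀ j : ℕ, z ^ p ^ j ≠ 1 := fun j hj => hne j (Subtype.ext hj)
  have hcomm : ∀ (x : G) (k : ℤ), Commute x (z ^ k) := fun x k =>
    mem_center_iff.mp (zpow_mem hz k) x
  have key : ∀ j : ℕ, ∃ m : ℕ, m.Coprime p ∧ ∃ y ∈ H, ∃ k : ℤ, g ^ m = y * z ^ (p ^ j * k) := by
    intro j
    have hnormal : (zpowers (z ^ p ^ j)).Normal :=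
      ⟨fun n hn x => by
        obtain ⟨k, rfl⟩ := mem_zpowers_iff.mp hn
        have := mem_center_iff.mp (zpow_mem (pow_mem hz (p ^ j)) k) x
        rw [this, mul_inv_cancel_right]
        exact zpow_mem (mem_zpowers _) k⟩
    by_contra! hcon
    have hle : AvoidsCoprimePowers p g (H ⊔ zpowers (z ^ p ^ j)) := by
      intro m hm hmem
      obtain ⟨y, hy, w, hw, hyw⟩ := mem_sup_of_normal_right.mp hmem
      obtain ⟨k, rfl⟩ := mem_zpowers_iff.mp hw
      refine hcon m hm y hy k ?_
      rw [← hyw, zpow_mul]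
      norm_cast
    exact hpow j (hone _ (pow_mem hz _)
      (h.le_of_ge hle le_sup_left (mem_sup_right (mem_zpowers _))))
  by_cases hord : orderOf z = 0
  · obtain ⟨m, hm, y, hy, k, hk⟩ := key 0
    rw [pow_zero, one_mul] at hk
    have hdvd : ∀ j : ℕ, (p : ℤ) ^ j ∣ k := by
      intro j
      obtain ⟨m', hm', y', hy', k', hk'⟩ := key j
      have heq : y ^ m' * z ^ (k * m') = y' ^ m * z ^ (p ^ j * k' * m) := by
        rw [zpow_mul, zpow_mul _ _ (m : ℤ), zpow_natCast, zpow_natCast,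
          ← (hcomm y k).mul_pow, ← (hcomm y' _).mul_pow, ← hk, ← hk', ← pow_mul, ← pow_mul,
          mul_comm]
      have hmem : z ^ (k * m' - p ^ j * k' * m) = (y ^ m')⁻¹ * y' ^ m := by
        rw [zpow_sub, eq_inv_mul_iff_mul_eq, ← mul_assoc, heq, mul_inv_cancel_right]
      have hz1 := hone _ (zpow_mem hz _)
        (hmem ▸ mul_mem (inv_mem (pow_mem hy _)) (pow_mem hy' _))
      have := orderOf_dvd_iff_zpow_eq_one.mpr hz1
      rw [hord, Nat.cast_zero, zero_dvd_iff, sub_eq_zero] at this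
      have hcop : IsCoprime ((p : ℤ) ^ j) m' := (Nat.isCoprime_iff_coprime.mpr hm'.symm).pow_left
      exact hcop.dvd_of_dvd_mul_right ⟨k' * m, by rw [this]; ring⟩
    have hk0 : k = 0 := by
      by_contra hk0
      obtain ⟨j, hj⟩ :=
        Int.finiteMultiplicity_iff (a := (p : ℤ)).mpr ⟨by simpa using hp.ne_one, hk0⟩
      exact hj (hdvd _)
    rw [hk0, zpow_zero, mul_one] at hk
    exact h.prop m hm (hk ▸ hy)
  · obtain ⟨a, b, hb, hab⟩ := Nat.exists_eq_pow_mul_and_not_dvd hord p hp.ne_one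
    obtain ⟨m, hm, y, hy, k, hk⟩ := key a
    refine h.prop (m * b) (hm.mul_left ((hp.coprime_iff_not_dvd.mpr hb).symm)) ?_
    have hzb : z ^ ((p : ℤ) ^ a * k * b) = 1 := by
      rw [show (p : ℤ) ^ a * k * b = (orderOf z : ℕ) * k by rw [hab]; push_cast; ring, zpow_mul,
        zpow_natCast, pow_orderOf_eq_one, one_zpow]
    rw [pow_mul, hk, (hcomm y _).mul_pow, ← zpow_natCast (z ^ _), ← zpow_mul, hzb, mul_one]
    exact pow_mem hy b

/-- A maximal subgroup containing no power of `g` with exponent prime to `p` in a finitely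
generated nilpotent group has a core whose quotient is a finite `p`-group. -/
theorem AvoidsCoprimePowers.finite_isPGroup_quotient_normalCore {G : Type*} [Group G]
    [Group.FG G] [Group.IsNilpotent G] {p : ℕ} (hp : p.Prime) {g : G} {H : Subgroup G}
    (h : Maximal (AvoidsCoprimePowers p g) H) :
    Finite (G ⧸ H.normalCore) ∧ IsPGroup p (G ⧸ H.normalCore) := by
  have hker : (QuotientGroup.mk' H.normalCore).ker ≤ H := by
    rw [QuotientGroup.ker_mk']
    exact H.normalCore_le
  have hmax := maximal_map h (QuotientGroup.mk'_surjective H.normalCore) hker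
  have hpgroup : IsPGroup p (G ⧸ H.normalCore) := by
    refine IsPGroup.of_center (isPGroup_center hp hmax ?_)
    rw [Subgroup.disjoint_def]
    intro x hxH hxZ
    induction x using QuotientGroup.induction_on with
    | H x =>
    rw [QuotientGroup.eq_one_iff]
    intro b
    have hconj : QuotientGroup.mk' H.normalCore (b * x * b⁻¹) = QuotientGroup.mk' _ x := by
      rw [map_mul, map_mul, map_inv]
      exact mul_inv_eq_of_eq_mul (Subgroup.mem_center_iff.mp hxZ _)
    have : b * x * b⁻¹ ∈ (H.map (QuotientGroup.mk' H.normalCore)).comap _ :=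
      Subgroup.mem_comap.mpr (Eq.mpr (congrArg (· ∈ _) hconj) hxH)
    rwa [Subgroup.comap_map_eq_self hker] at this
  refine ⟨finite_of_fg_of_isSolvable_of_torsion fun x => ?_, hpgroup⟩
  obtain ⟨k, hk⟩ := hpgroup x
  exact isOfFinOrder_iff_pow_eq_one.mpr ⟨p ^ k, pow_pos hp.pos k, hk⟩

/-- Allenby–Gregorac: if `H ≤ G` with `G` finitely generated nilpotent and `g ∈ G \ H`
satisfies `g^n ∉ H` for all `n ≥ 1`, then for any prime `p` the element `g` and the
subgroup `H` can be separated in a finite `p`-group. -/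
theorem separated_in_finite_p_group
    {G : Type*} [Group G] [Group.FG G] [Group.IsNilpotent G]
    (H : Subgroup G) (g : G) (hg : g ∉ H)
    (hpow : ∀ n : ℕ, 1 ≤ n → g ^ n ∉ H) (p : ℕ) (hp : p.Prime) :
    ∃ (K : Type) (_ : Group K) (_ : Finite K), IsPGroup p K ∧
      ∃ φ : G →* K, Function.Surjective φ ∧ φ g ∉ φ '' (H : Set G) := by
  have havoid : AvoidsCoprimePowers p g H := fun m hm =>
    hpow m (Nat.one_le_iff_ne_zero.mpr fun hm0 => hp.ne_one (by simpa [hm0] using hm))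
  obtain ⟨M, hHM, hM⟩ := havoid.exists_le_maximal
  obtain ⟨hfin, hpgroup⟩ := AvoidsCoprimePowers.finite_isPGroup_quotient_normalCore hp hM
  let e : Shrink.{0} (G ⧸ M.normalCore) ≃* G ⧸ M.normalCore := Shrink.mulEquiv
  refine ⟨Shrink.{0} (G ⧸ M.normalCore), inferInstance, inferInstance,
    hpgroup.of_equiv e.symm,
    e.symm.toMonoidHom.comp (QuotientGroup.mk' M.normalCore),
    e.symm.surjective.comp (QuotientGroup.mk'_surjective _), ?_⟩
  rintro ⟨x, hx, hxg⟩
  have hmem : x⁻¹ * g ∈ M := M.normalCore_le (QuotientGroup.eq.mp (e.symm.injective hxg))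
  have hgM : g ∈ M := by simpa using mul_mem (hHM hx) hmem
  exact hM.prop 1 (Nat.coprime_one_left p) (by simpa using hgM)
end

section
/- Let G be a finitely generated nilpotent group that is infinite. Then the center Z(G) contains an element of infinite order. -/
/-- In a group generated by finitely many elements whose center is torsion, the center of the
quotient by the center is torsion. -/
theorem isTorsion_center_quotient_center {G : Type*} [Group G] [Group.FG G]
    (h : ∀ z ∈ Subgroup.center G, IsOfFinOrder z) :
    ∀ z ∈ Subgroup.center (G ⧸ Subgroup.center G), IsOfFinOrder z := by
  intro z hz
  obtain ⟨x, rfl⟩ := QuotientGroup.mk_surjective z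
  have hc : ∀ s : G, s * x * s⁻¹ * x⁻¹ ∈ Subgroup.center G := fun s ↦ by
    rw [← QuotientGroup.eq_one_iff]
    have := Subgroup.mem_center_iff.1 hz (s : G ⧸ Subgroup.center G)
    rw [QuotientGroup.mk_mul, QuotientGroup.mk_mul, QuotientGroup.mk_mul, this]
    simp
  obtain ⟨S, hS⟩ := Group.FG.out (G := G)
  set k := ∏ s ∈ S, orderOf (s * x * s⁻¹ * x⁻¹)
  have hk_pos : 0 < k := Finset.prod_pos fun s _ ↦ (h _ (hc s)).orderOf_pos
  refine isOfFinOrder_iff_pow_eq_one.2 ⟨k, hk_pos, ?_⟩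
  rw [← QuotientGroup.mk_pow, QuotientGroup.eq_one_iff, ← Subgroup.centralizer_univ,
    ← Subgroup.coe_top, ← hS, Subgroup.centralizer_closure, Subgroup.mem_centralizer_iff]
  intro s hs
  have hpow : (s * x * s⁻¹ * x⁻¹) ^ k = 1 :=
    orderOf_dvd_iff_pow_eq_one.1 (Finset.dvd_prod_of_mem _ hs)
  have hcomm : Commute (s * x * s⁻¹ * x⁻¹) x := (Subgroup.mem_center_iff.1 (hc s) x).symm
  have hconj : s * x ^ k * s⁻¹ = x ^ k := by
    rw [← conj_pow, ← inv_mul_cancel_right (s * x * s⁻¹) x, hcomm.mul_pow, hpow, one_mul]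
  exact mul_inv_eq_iff_eq_mul.1 hconj

open scoped IsMulCommutative in
/-- A finitely generated nilpotent group whose center is torsion is finite. -/
theorem finite_of_isTorsion_center {G : Type*} [Group G] [Group.FG G] [Group.IsNilpotent G]
    (h : ∀ z ∈ Subgroup.center G, IsOfFinOrder z) : Finite G := by
  refine Group.nilpotent_center_quotient_ind
    (P := fun G _ _ ↦ Group.FG G → (∀ z ∈ Subgroup.center G, IsOfFinOrder z) → Finite G)
    G (fun G _ _ _ _ ↦ inferInstance) (fun G _ _ ih _ h ↦ ?_) ‹_› h
  have : Finite (G ⧸ Subgroup.center G) := ih inferInstance (isTorsion_center_quotient_center h)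
  have : (Subgroup.center G).FiniteIndex := Subgroup.finiteIndex_of_finite_quotient
  have : Finite (Subgroup.center G) :=
    CommGroup.finite_of_fg_isMulTorsion _ fun z ↦ Submonoid.isOfFinOrder_coe.1 (h z z.2)
  exact Finite.of_subgroup_quotient (Subgroup.center G)

/-- The center of an infinite finitely generated nilpotent group contains an
element of infinite order. -/
theorem center_has_element_of_infinite_order
    {G : Type*} [Group G] [Group.FG G] [Group.IsNilpotent G] [Infinite G] :
    ∃ z ∈ Subgroup.center G, ¬ IsOfFinOrder z := by
  by_contra! h
  exact not_finite_iff_infinite.2 ‹Infinite G› (finite_of_isTorsion_center h)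
end

section
/- Let G be a nilpotent group and let H be a subgroup of G. Then the set I(H, G) = {g ∈ G : g^n ∈ H for some integer n ≥ 1} is a subgroup of G; moreover it is isolated, and it is contained in every isolated subgroup of G that contains H. -/
open Subgroup
open scoped commutatorElement

section CentralCommutator

variable {G : Type*} [Group G]

theorem commutatorElement_pow_right_of_mem_center {u v : G} (h : ⁅u, v⁆ ∈ center G) (l : ℕ) :
    ⁅u, v ^ l⁆ = ⁅u, v⁆ ^ l := by
  have hc : Commute ⁅u, v⁆ v := (mem_center_iff.mp h v).symm
  have hconj : u * v * u⁻¹ = ⁅u, v⁆ * v := by simp [commutatorElement_def]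
  rw [commutatorElement_def u (v ^ l), ← conj_pow, hconj, hc.mul_pow, mul_inv_cancel_right]

theorem commutatorElement_pow_pow_of_mem_center {u v : G} (h : ⁅u, v⁆ ∈ center G) (k l : ℕ) :
    ⁅u ^ k, v ^ l⁆ = ⁅u, v⁆ ^ (k * l) := by
  have hvu : ⁅v, u⁆ ∈ center G := by
    rw [← commutatorElement_inv]
    exact inv_mem h
  have hk : ⁅u ^ k, v⁆ = ⁅u, v⁆ ^ k := by
    rw [← commutatorElement_inv, commutatorElement_pow_right_of_mem_center hvu, ← inv_pow,
      commutatorElement_inv]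
  rw [commutatorElement_pow_right_of_mem_center (hk ▸ pow_mem h k), hk, pow_mul]

theorem commutatorElement_mul_mul_of_mem_center {a b z w : G} (hz : z ∈ center G)
    (hw : w ∈ center G) : ⁅a * z, b * w⁆ = ⁅a, b⁆ := by
  have hz' (g : G) : z * g = g * z := (mem_center_iff.mp hz g).symm
  have hw' (g : G) : w * g = g * w := (mem_center_iff.mp hw g).symm
  calc ⁅a * z, b * w⁆ = a * (z * b) * w * z⁻¹ * a⁻¹ * w⁻¹ * b⁻¹ := by
        simp [commutatorElement_def, mul_assoc]
    _ = a * b * (z * w) * z⁻¹ * a⁻¹ * w⁻¹ * b⁻¹ := by rw [hz' b]; simp only [mul_assoc]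
    _ = a * b * (w * a⁻¹) * w⁻¹ * b⁻¹ := by rw [hz' w]; simp only [mul_assoc, mul_inv_cancel_left]
    _ = ⁅a, b⁆ := by rw [hw' a⁻¹]; simp [commutatorElement_def, mul_assoc]

end CentralCommutator

namespace Subgroup

variable {G : Type*} [Group G]

/-- The elements of `G` having some positive power in `H`. -/
def rootSet (H : Subgroup G) : Set G := {g : G | ∃ n : ℕ, 1 ≤ n ∧ g ^ n ∈ H}

theorem one_mem_rootSet (H : Subgroup G) : 1 ∈ H.rootSet :=
  ⟨1, le_rfl, by simp⟩

theorem subset_rootSet (H : Subgroup G) : (H : Set G) ⊆ H.rootSet :=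
  fun g hg => ⟨1, le_rfl, by simpa using hg⟩

theorem inv_mem_rootSet {H : Subgroup G} {g : G} (hg : g ∈ H.rootSet) : g⁻¹ ∈ H.rootSet := by
  obtain ⟨n, hn, h⟩ := hg
  exact ⟨n, hn, by simpa using h⟩

theorem mem_rootSet_of_pow_mem {H : Subgroup G} {g : G} {n : ℕ} (hn : 1 ≤ n)
    (hg : g ^ n ∈ H.rootSet) : g ∈ H.rootSet := by
  obtain ⟨m, hm, h⟩ := hg
  exact ⟨n * m, Nat.mul_pos hn hm, by rwa [pow_mul]⟩

theorem mul_mem_rootSet_of_commute {H : Subgroup G} {a b : G} (hab : Commute a b)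
    (ha : a ∈ H.rootSet) (hb : b ∈ H.rootSet) : a * b ∈ H.rootSet := by
  obtain ⟨n, hn, han⟩ := ha
  obtain ⟨m, hm, hbm⟩ := hb
  refine ⟨n * m, Nat.mul_pos hn hm, ?_⟩
  rw [hab.mul_pow, pow_mul, mul_comm n m, pow_mul b]
  exact mul_mem (pow_mem han m) (pow_mem hbm n)

theorem closure_subset_rootSet_of_le_center {H : Subgroup G} {S : Set G}
    (hS : S ⊆ H.rootSet) (hc : closure S ≤ center G) : (closure S : Set G) ⊆ H.rootSet := by
  intro g hg
  induction hg using closure_induction with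
  | mem x hx => exact hS hx
  | one => exact H.one_mem_rootSet
  | mul x y hx _ hx' hy' =>
    exact mul_mem_rootSet_of_commute (mem_center_iff.mp (hc hx) y).symm hx' hy'
  | inv x _ hx' => exact inv_mem_rootSet hx'

theorem image_rootSet_subset {K : Type*} [Group K] (f : G →* K) (H : Subgroup G) :
    f '' H.rootSet ⊆ (H.map f).rootSet := by
  rintro _ ⟨g, ⟨n, hn, h⟩, rfl⟩
  exact ⟨n, hn, by simpa using mem_map_of_mem f h⟩

theorem lowerCentralSeries_le_center {c : ℕ}
    (hc : (⊤ : Subgroup G).lowerCentralSeries (c + 1) = ⊥) :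
    (⊤ : Subgroup G).lowerCentralSeries c ≤ center G := by
  intro z hz
  rw [mem_center_iff]
  intro g
  have h : ⁅z, g⁆ ∈ (⊤ : Subgroup G).lowerCentralSeries (c + 1) :=
    commutator_mem_commutator hz (mem_top g)
  rw [hc, mem_bot, commutatorElement_eq_one_iff_mul_comm] at h
  exact h.symm

theorem rootSet_eq_univ_of_closure_eq_top (c : ℕ) :
    ∀ {G : Type*} [Group G], (⊤ : Subgroup G).lowerCentralSeries (c + 1) = ⊥ →
      ∀ H : Subgroup G, closure H.rootSet = ⊤ → H.rootSet = Set.univ := by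
  induction c with
  | zero =>
    intro G _ hG H hH
    have hsub := closure_subset_rootSet_of_le_center (subset_refl H.rootSet)
      (hH.trans_le (lowerCentralSeries_le_center hG))
    rwa [hH, coe_top, Set.univ_subset_iff] at hsub
  | succ c ih =>
    intro G _ hG H hH
    set Γ := (⊤ : Subgroup G).lowerCentralSeries (c + 1) with hΓ
    have hcent : Γ ≤ center G := lowerCentralSeries_le_center hG
    have hQ : (⊤ : Subgroup (G ⧸ Γ)).lowerCentralSeries (c + 1) = ⊥ := by
      rw [← map_top_of_surjective _ (QuotientGroup.mk'_surjective Γ), ← map_lowerCentralSeries,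
        ← hΓ, QuotientGroup.map_mk'_self]
    have hroot : (H.map (QuotientGroup.mk' Γ)).rootSet = Set.univ := by
      refine ih hQ _ (top_le_iff.mp ?_)
      have hmap := congrArg (map (QuotientGroup.mk' Γ)) hH
      rw [map_top_of_surjective _ (QuotientGroup.mk'_surjective Γ), MonoidHom.map_closure] at hmap
      exact hmap.ge.trans (closure_mono (image_rootSet_subset _ H))
    have hfac (g : G) : ∃ n : ℕ, 1 ≤ n ∧ ∃ h ∈ H, ∃ z ∈ Γ, g ^ n = h * z := by
      obtain ⟨n, hn, h, hh, heq⟩ : (g : G ⧸ Γ) ∈ (H.map (QuotientGroup.mk' Γ)).rootSet :=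
        hroot ▸ Set.mem_univ _
      exact ⟨n, hn, h, hh, h⁻¹ * g ^ n, QuotientGroup.eq.mp heq, by simp⟩
    have hΓroot : (Γ : Set G) ⊆ H.rootSet := by
      have hcl : Γ = closure {g | ∃ u ∈ (⊤ : Subgroup G).lowerCentralSeries c,
          ∃ v ∈ (⊤ : Subgroup G), ⁅u, v⁆ = g} := rfl
      rw [hcl]
      refine closure_subset_rootSet_of_le_center ?_ (hcl ▸ hcent)
      rintro _ ⟨u, hu, v, hv, rfl⟩
      obtain ⟨k, hk, a, ha, z, hz, hukz⟩ := hfac u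
      obtain ⟨l, hl, b, hb, w, hw, hvlw⟩ := hfac v
      refine ⟨k * l, Nat.mul_pos hk hl, ?_⟩
      rw [← commutatorElement_pow_pow_of_mem_center (hcent (commutator_mem_commutator hu hv)),
        hukz, hvlw, commutatorElement_mul_mul_of_mem_center (hcent hz) (hcent hw),
        commutatorElement_def]
      exact mul_mem (mul_mem (mul_mem ha hb) (inv_mem ha)) (inv_mem hb)
    refine Set.eq_univ_of_forall fun g => ?_
    obtain ⟨n, hn, h, hh, z, hz, hgn⟩ := hfac g
    refine mem_rootSet_of_pow_mem hn (hgn ▸ ?_)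
    exact mul_mem_rootSet_of_commute (mem_center_iff.mp (hcent hz) h)
      (H.subset_rootSet hh) (hΓroot hz)

theorem coe_closure_rootSet [Group.IsNilpotent G] (H : Subgroup G) :
    (closure H.rootSet : Set G) = H.rootSet := by
  refine Set.Subset.antisymm (fun g hg => ?_) subset_closure
  obtain ⟨c, hc⟩ := nilpotent_iff_lowerCentralSeries.mp
    (inferInstance : Group.IsNilpotent (closure H.rootSet))
  have hc' : (⊤ : Subgroup (closure H.rootSet)).lowerCentralSeries (c + 1) = ⊥ :=
    le_bot_iff.mp (hc ▸ lowerCentralSeries_antitone _ c.le_succ)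
  have hpre : (H.subgroupOf (closure H.rootSet)).rootSet =
      ((↑) : closure H.rootSet → G) ⁻¹' H.rootSet := rfl
  have huniv := rootSet_eq_univ_of_closure_eq_top c hc' (H.subgroupOf (closure H.rootSet))
    (by rw [hpre]; exact closure_closure_coe_preimage)
  have hmem : (⟨g, hg⟩ : closure H.rootSet) ∈ (H.subgroupOf (closure H.rootSet)).rootSet :=
    huniv ▸ Set.mem_univ _
  rwa [hpre] at hmem

end Subgroup

/-- In a nilpotent group `G`, the set `{g | g ^ n ∈ H for some n ≥ 1}` is a subgroup,
it is isolated, and it is contained in every isolated subgroup of `G` containing `H`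
(i.e. it is the isolator `I(H, G)`). -/
theorem isolator_is_subgroup_isolated_and_least
    {G : Type*} [Group G] [Group.IsNilpotent G] (H : Subgroup G) :
    ∃ K : Subgroup G,
      (K : Set G) = {g : G | ∃ n : ℕ, 1 ≤ n ∧ g ^ n ∈ H} ∧
      (∀ (g : G) (n : ℕ), 1 ≤ n → g ^ n ∈ K → g ∈ K) ∧
      ∀ L : Subgroup G,
        (∀ (g : G) (n : ℕ), 1 ≤ n → g ^ n ∈ L → g ∈ L) → H ≤ L → K ≤ L := by
  refine ⟨closure H.rootSet, H.coe_closure_rootSet, fun g n hn hg => ?_, fun L hL hHL => ?_⟩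
  · rw [← SetLike.mem_coe, H.coe_closure_rootSet] at hg ⊢
    exact mem_rootSet_of_pow_mem hn hg
  · rw [closure_le]
    rintro g ⟨n, hn, h⟩
    exact hL g n hn (hHL h)
end
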